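/- Let b > 0 and let K = (K_{ij}) be a real symmetric positive definite 2×2 matrix. Set t_K = Tr K, d_K = det K, s₁ = (1/√2)·√( t_K + b² − √( (t_K + b²)² − 4d_K ) ), and s₂ = (1/√2)·√( t_K + b² + √( (t_K + b²)² − 4d_K ) ). Then for all n₁, n₂ ∈ ℕ there exists a nonzero Schwartz function u : ℝ² → ℂ such that, for all (x,y) ∈ ℝ², applying the operator H_{b,K} = (i∂_x − by/2)² + (i∂_y + bx/2)² + (K₁₁x² + 2K₁₂xy + K₂₂y²) to u gives H_{b,K}u = ( (2n₁+1)s₁ + (2n₂+1)s₂ )·u. -/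

import Mathlib

/-- First partial derivative of a complex-valued function on `ℝ × ℝ`. -/
noncomputable def pd1 (f : ℝ × ℝ → ℂ) (p : ℝ × ℝ) : ℂ := fderiv ℝ f p (1, 0)

/-- Second partial derivative of a complex-valued function on `ℝ × ℝ`. -/
noncomputable def pd2 (f : ℝ × ℝ → ℂ) (p : ℝ × ℝ) : ℂ := fderiv ℝ f p (0, 1)

/-- The first-order operator `i∂_x − (b/2)y` in the symmetric gauge. -/
noncomputable def magOp1 (b : ℝ) (f : ℝ × ℝ → ℂ) (p : ℝ × ℝ) : ℂ :=
  Complex.I * pd1 f p - ((b / 2 * p.2 : ℝ) : ℂ) * f p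

/-- The first-order operator `i∂_y + (b/2)x` in the symmetric gauge. -/
noncomputable def magOp2 (b : ℝ) (f : ℝ × ℝ → ℂ) (p : ℝ × ℝ) : ℂ :=
  Complex.I * pd2 f p + ((b / 2 * p.1 : ℝ) : ℂ) * f p

theorem pow_apply_ne_zero_of_commutator {V : Type*} [AddCommGroup V] [Module ℂ V]
    (D A : V →ₗ[ℂ] V) (h : ∀ v, D (A v) = A (D v) + v) {w : V} (hD : D w = 0) (hw : w ≠ 0)
    (n : ℕ) : (A ^ n) w ≠ 0 := by
  have key : ∀ n : ℕ, D ((A ^ (n + 1)) w) = ((n : ℂ) + 1) • (A ^ n) w := by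
    intro n
    induction n with
    | zero => simp [h, hD]
    | succ n ih =>
      rw [pow_succ', Module.End.mul_apply, h, ih, map_smul, ← Module.End.mul_apply, ← pow_succ']
      push_cast
      module
  induction n with
  | zero => simpa using hw
  | succ n ih =>
    intro h0
    have h1 := key n
    rw [h0, map_zero] at h1
    exact (smul_ne_zero (by exact_mod_cast Nat.succ_ne_zero n) ih) h1.symm

theorem pow_apply_eigenvector_of_commutator {V : Type*} [AddCommGroup V] [Module ℂ V]
    (T A : V →ₗ[ℂ] V) (s : ℂ) (h : ∀ v, T (A v) = A (T v) + s • A v) {w : V} {μ : ℂ}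
    (hw : T w = μ • w) (n : ℕ) : T ((A ^ n) w) = (μ + n * s) • (A ^ n) w := by
  induction n with
  | zero => simp [hw]
  | succ n ih =>
    rw [pow_succ', Module.End.mul_apply, h, ih, map_smul]
    push_cast
    module

theorem pow_apply_mem_ker_of_commute {V : Type*} [AddCommGroup V] [Module ℂ V]
    (D A : V →ₗ[ℂ] V) (h : ∀ v, D (A v) = A (D v)) {w : V} (hw : D w = 0) (n : ℕ) :
    D ((A ^ n) w) = 0 := by
  induction n with
  | zero => simp [hw]
  | succ n ih => rw [pow_succ', Module.End.mul_apply, h, ih, map_zero]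

theorem exists_eigenvector_of_weyl_relations {V : Type*} [AddCommGroup V] [Module ℂ V]
    (z₁ z₂ D₁ D₂ : V →ₗ[ℂ] V)
    (h11 : ∀ v, D₁ (z₁ v) = z₁ (D₁ v) + v) (h12 : ∀ v, D₁ (z₂ v) = z₂ (D₁ v))
    (h21 : ∀ v, D₂ (z₁ v) = z₁ (D₂ v)) (h22 : ∀ v, D₂ (z₂ v) = z₂ (D₂ v) + v)
    (hz : ∀ v, z₂ (z₁ v) = z₁ (z₂ v)) (hD : ∀ v, D₂ (D₁ v) = D₁ (D₂ v))
    (g₁ g₁₂ g₂ s₁ s₂ : ℂ) (hs₁ : s₁ ≠ 0) (hs₂ : s₂ ≠ 0) (hs : s₁ + s₂ ≠ 0)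
    {v₀ : V} (hv₀ : v₀ ≠ 0) (hv₁ : D₁ v₀ = 0) (hv₂ : D₂ v₀ = 0) (n₁ n₂ : ℕ) :
    ∃ v ≠ 0, -(g₁ • D₁ (D₁ v) + (2 * g₁₂) • D₁ (D₂ v) + g₂ • D₂ (D₂ v))
      + (2 * s₁) • z₁ (D₁ v) + (2 * s₂) • z₂ (D₂ v) = (2 * n₁ * s₁ + 2 * n₂ * s₂) • v := by
  let A₁ : V →ₗ[ℂ] V := z₁ - (g₁ / (s₁ + s₁)) • D₁ - (g₁₂ / (s₁ + s₂)) • D₂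
  let A₂ : V →ₗ[ℂ] V := z₂ - (g₁₂ / (s₁ + s₂)) • D₁ - (g₂ / (s₂ + s₂)) • D₂
  let T : V →ₗ[ℂ] V := -(g₁ • (D₁ ∘ₗ D₁) + (2 * g₁₂) • (D₁ ∘ₗ D₂) + g₂ • (D₂ ∘ₗ D₂))
      + (2 * s₁) • (z₁ ∘ₗ D₁) + (2 * s₂) • (z₂ ∘ₗ D₂)
  have hss₁ : s₁ + s₁ ≠ 0 := by rw [← two_mul]; exact mul_ne_zero two_ne_zero hs₁
  have hss₂ : s₂ + s₂ ≠ 0 := by rw [← two_mul]; exact mul_ne_zero two_ne_zero hs₂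
  have hTA₁ : ∀ v, T (A₁ v) = A₁ (T v) + (2 * s₁) • A₁ v := by
    intro v
    simp [T, A₁, h11, h12, h21, h22, hz, hD]
    match_scalars <;> field_simp <;> ring
  have hTA₂ : ∀ v, T (A₂ v) = A₂ (T v) + (2 * s₂) • A₂ v := by
    intro v
    simp [T, A₂, h11, h12, h21, h22, hz, hD]
    match_scalars <;> field_simp <;> ring
  have hDA₁₁ : ∀ v, D₁ (A₁ v) = A₁ (D₁ v) + v := by
    intro v
    simp [A₁, h11, hD]
    module
  have hDA₁₂ : ∀ v, D₁ (A₂ v) = A₂ (D₁ v) := by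
    intro v
    simp [A₂, h12, hD]
  have hDA₂₂ : ∀ v, D₂ (A₂ v) = A₂ (D₂ v) + v := by
    intro v
    simp [A₂, h22, hD]
    module
  have hT₀ : T v₀ = (0 : ℂ) • v₀ := by simp [T, hv₁, hv₂]
  refine ⟨(A₁ ^ n₁) ((A₂ ^ n₂) v₀), ?_, ?_⟩
  · exact pow_apply_ne_zero_of_commutator D₁ A₁ hDA₁₁ (pow_apply_mem_ker_of_commute D₁ A₂ hDA₁₂ hv₁ n₂)
      (pow_apply_ne_zero_of_commutator D₂ A₂ hDA₂₂ hv₂ hv₀ n₂) n₁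
  · have := pow_apply_eigenvector_of_commutator T A₁ (2 * s₁) hTA₁
      (pow_apply_eigenvector_of_commutator T A₂ (2 * s₂) hTA₂ hT₀ n₂) n₁
    refine Eq.trans ?_ (this.trans ?_)
    · simp [T]
    · congr 1
      ring

theorem exists_left_diagonalization (n₁₁ n₁₂ n₂₁ n₂₂ s₁ s₂ : ℂ) (htr : n₁₁ + n₂₂ = s₁ + s₂)
    (hdet : n₁₁ * n₂₂ - n₁₂ * n₂₁ = s₁ * s₂) (hs : s₁ ≠ s₂) (hn : n₁₂ ≠ n₂₁) :
    ∃ a b c d : ℂ, a * d - b * c = 1 ∧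
      n₁₁ = d * s₁ * a - b * s₂ * c ∧ n₁₂ = d * s₁ * b - b * s₂ * d ∧
      n₂₁ = -c * s₁ * a + a * s₂ * c ∧ n₂₂ = -c * s₁ * b + a * s₂ * d := by
  have hs' : s₁ - s₂ ≠ 0 := sub_ne_zero.mpr hs
  obtain rfl : n₂₂ = s₁ + s₂ - n₁₁ := by linear_combination htr
  by_cases h : n₁₂ = 0
  · subst h
    have h21 : n₂₁ ≠ 0 := hn.symm
    refine ⟨n₂₁, s₁ - n₁₁, -1 / (s₁ - s₂), -(s₂ - n₁₁) / ((s₁ - s₂) * n₂₁), ?_, ?_, ?_, ?_, ?_⟩ <;>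
      field_simp <;> first | ring1 | linear_combination -(s₁ - s₂) * hdet
  · refine ⟨s₁ - (s₁ + s₂ - n₁₁), n₁₂, (s₂ - (s₁ + s₂ - n₁₁)) / ((s₁ - s₂) * n₁₂), 1 / (s₁ - s₂),
      ?_, ?_, ?_, ?_, ?_⟩ <;>
      field_simp <;> first | ring1 | linear_combination -(s₁ - s₂) * hdet
open SchwartzMap

theorem norm_iteratedFDeriv_cexp_eq (n : ℕ) (z : ℂ) :
    ‖iteratedFDeriv ℝ n Complex.exp z‖
      = ‖Complex.exp z‖ * ‖iteratedFDeriv ℝ n Complex.exp 0‖ := by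
  have h1 := iteratedFDeriv_comp_add_right (𝕜 := ℝ) (f := Complex.exp) n z 0
  have h2 : (fun w : ℂ => Complex.exp (w + z)) = Complex.exp z • Complex.exp := by
    ext w
    simp [Complex.exp_add, mul_comm]
  rw [zero_add] at h1
  rw [← h1, h2, iteratedFDeriv_const_smul_apply (Complex.contDiff_exp.contDiffAt), norm_smul]

theorem pow_mul_exp_neg_mul_sq_le {c : ℝ} (hc : 0 < c) (N : ℕ) {r : ℝ} (hr : 0 ≤ r) :
    (1 + r) ^ N * Real.exp (-c * r ^ 2) ≤ N.factorial * Real.exp (1 + 1 / (4 * c)) := by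
  have h1 : (1 + r) ^ N ≤ N.factorial * Real.exp (1 + r) := by
    have := Real.pow_div_factorial_le_exp (1 + r) (by positivity) N
    rwa [div_le_iff₀' (by positivity)] at this
  calc (1 + r) ^ N * Real.exp (-c * r ^ 2)
      ≤ N.factorial * Real.exp (1 + r) * Real.exp (-c * r ^ 2) := by gcongr
    _ = N.factorial * Real.exp (1 + r + -c * r ^ 2) := by rw [mul_assoc, ← Real.exp_add]
    _ ≤ _ := by
      gcongr ?_ * Real.exp ?_
      have : 1 / (4 * c) - (r - c * r ^ 2) = c * (r - 1 / (2 * c)) ^ 2 := by field_simp; ring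
      nlinarith [mul_nonneg hc.le (sq_nonneg (r - 1 / (2 * c)))]

theorem exists_schwartzMap_cexp {E : Type*} [NormedAddCommGroup E] [NormedSpace ℝ E] {f : E → ℂ}
    (hf : f.HasTemperateGrowth) {c : ℝ} (hc : 0 < c) (hre : ∀ x, (f x).re ≤ -c * ‖x‖ ^ 2) :
    ∃ u : 𝓢(E, ℂ), ∀ x, u x = Complex.exp (f x) := by
  refine ⟨⟨Complex.exp ∘ f, Complex.contDiff_exp.comp hf.1, ?_⟩, fun x => rfl⟩
  intro k n
  obtain ⟨m, C, hC, hCf⟩ := hf.norm_iteratedFDeriv_le_uniform n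
  let B : ℝ := ∑ i ∈ Finset.range (n + 1), ‖iteratedFDeriv ℝ i Complex.exp 0‖
  have hB : 0 ≤ B := by positivity
  refine ⟨n.factorial * B * (1 + C) ^ n *
    ((k + m * n).factorial * Real.exp (1 + 1 / (4 * c))), fun x => ?_⟩
  have hx : 0 ≤ ‖x‖ := norm_nonneg x
  have key : ‖iteratedFDeriv ℝ n (Complex.exp ∘ f) x‖
      ≤ n.factorial * (Real.exp (-c * ‖x‖ ^ 2) * B) * ((1 + C) * (1 + ‖x‖) ^ m) ^ n := by
    refine norm_iteratedFDeriv_comp_le (N := n) (Complex.contDiff_exp.of_le le_top)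
      (hf.1.of_le (by exact_mod_cast le_top)) le_rfl x ?_ ?_
    · intro i hi
      rw [norm_iteratedFDeriv_cexp_eq, Complex.norm_exp]
      gcongr
      · exact hre x
      · exact Finset.single_le_sum (f := fun i => ‖iteratedFDeriv ℝ i Complex.exp 0‖)
          (fun _ _ => norm_nonneg _) (Finset.mem_range.mpr (by omega))
    · intro i hi hin
      have h1 : 1 ≤ (1 + C) * (1 + ‖x‖) ^ m :=
        one_le_mul_of_one_le_of_one_le (by linarith) (one_le_pow₀ (by linarith))
      calc _ ≤ C * (1 + ‖x‖) ^ m := hCf i hin x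
        _ ≤ (1 + C) * (1 + ‖x‖) ^ m := by gcongr; linarith
        _ ≤ _ := le_self_pow₀ h1 (by omega)
  calc _ ≤ (1 + ‖x‖) ^ k *
        (n.factorial * (Real.exp (-c * ‖x‖ ^ 2) * B) * ((1 + C) * (1 + ‖x‖) ^ m) ^ n) := by
        gcongr
        linarith
    _ = n.factorial * B * (1 + C) ^ n * ((1 + ‖x‖) ^ (k + m * n) * Real.exp (-c * ‖x‖ ^ 2)) := by
        rw [mul_pow, ← pow_mul, pow_add]; ring
    _ ≤ _ := by
        exact mul_le_mul_of_nonneg_left (pow_mul_exp_neg_mul_sq_le hc _ hx) (by positivity)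

theorem exists_eigenvector_of_magnetic_oscillator {V : Type*} [AddCommGroup V] [Module ℂ V]
    (X Y P₁ P₂ : V →ₗ[ℂ] V)
    (h11 : ∀ v, P₁ (X v) = X (P₁ v) + v) (h12 : ∀ v, P₁ (Y v) = Y (P₁ v))
    (h21 : ∀ v, P₂ (X v) = X (P₂ v)) (h22 : ∀ v, P₂ (Y v) = Y (P₂ v) + v)
    (hXY : ∀ v, Y (X v) = X (Y v)) (hP : ∀ v, P₂ (P₁ v) = P₁ (P₂ v))
    (β q₁₁ q₁₂ q₂₂ k m l s₁ s₂ : ℂ) (hβ : β ≠ 0)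
    (hk : k = q₁₁ ^ 2 + (q₁₂ + β) ^ 2) (hl : l = (q₁₂ - β) ^ 2 + q₂₂ ^ 2)
    (hm : m = q₁₁ * (q₁₂ - β) + (q₁₂ + β) * q₂₂)
    (htr : q₁₁ + q₂₂ = s₁ + s₂) (hdet : q₁₁ * q₂₂ - (q₁₂ - β) * (q₁₂ + β) = s₁ * s₂)
    (hs₁ : s₁ ≠ 0) (hs₂ : s₂ ≠ 0) (hs : s₁ + s₂ ≠ 0) (hne : s₁ ≠ s₂)
    {v₀ : V} (hv₀ : v₀ ≠ 0) (hv₁ : P₁ v₀ = -(q₁₁ • X v₀ + q₁₂ • Y v₀))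
    (hv₂ : P₂ v₀ = -(q₁₂ • X v₀ + q₂₂ • Y v₀)) (n₁ n₂ : ℕ) :
    ∃ v ≠ 0, -(P₁ (P₁ v) + P₂ (P₂ v)) + (2 * β) • (X (P₂ v) - Y (P₁ v))
      + (k - β ^ 2) • X (X v) + (2 * m) • X (Y v) + (l - β ^ 2) • Y (Y v)
      = ((2 * n₁ + 1) * s₁ + (2 * n₂ + 1) * s₂) • v := by
  obtain ⟨a, b, c, d, h1, e11, e12, e21, e22⟩ :=
    exists_left_diagonalization q₁₁ (q₁₂ - β) (q₁₂ + β) q₂₂ s₁ s₂ htr hdet hne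
      (fun h => hβ (by linear_combination (-1 / 2 : ℂ) * h))
  let a₁ : V →ₗ[ℂ] V := P₁ + q₁₁ • X + q₁₂ • Y
  let a₂ : V →ₗ[ℂ] V := P₂ + q₁₂ • X + q₂₂ • Y
  have ha₁ : a₁ v₀ = 0 := by simp [a₁, hv₁]
  have ha₂ : a₂ v₀ = 0 := by simp [a₂, hv₂]
  have k11 : ∀ v, a₁ (X v) = X (a₁ v) + v := by
    intro v; simp [a₁, h11, hXY]; module
  have k12 : ∀ v, a₁ (Y v) = Y (a₁ v) := by
    intro v; simp [a₁, h12, hXY]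
  have k21 : ∀ v, a₂ (X v) = X (a₂ v) := by
    intro v; simp [a₂, h21, hXY]
  have k22 : ∀ v, a₂ (Y v) = Y (a₂ v) + v := by
    intro v; simp [a₂, h22, hXY]; module
  have ka : ∀ v, a₂ (a₁ v) = a₁ (a₂ v) := by
    intro v; simp [a₁, a₂, h11, h12, h21, h22, hXY, hP]; module
  have hP₁ : ∀ v, P₁ v = a₁ v - q₁₁ • X v - q₁₂ • Y v := by
    intro v; simp [a₁]; abel
  have hP₂ : ∀ v, P₂ v = a₂ v - q₁₂ • X v - q₂₂ • Y v := by
    intro v; simp [a₂]; abel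
  have hH : ∀ v, -(P₁ (P₁ v) + P₂ (P₂ v)) + (2 * β) • (X (P₂ v) - Y (P₁ v))
      + (k - β ^ 2) • X (X v) + (2 * m) • X (Y v) + (l - β ^ 2) • Y (Y v)
      = -(a₁ (a₁ v) + a₂ (a₂ v)) + (2 : ℂ) • (q₁₁ • X (a₁ v) + (q₁₂ - β) • Y (a₁ v)
        + (q₁₂ + β) • X (a₂ v) + q₂₂ • Y (a₂ v)) + (s₁ + s₂) • v := by
    intro v
    subst hk hl hm
    rw [← htr]
    simp only [hP₁, hP₂, map_sub, map_smul, k11, k12, k21, k22, hXY]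
    module
  clear_value a₁ a₂
  let D₁ : V →ₗ[ℂ] V := d • a₁ - c • a₂
  let D₂ : V →ₗ[ℂ] V := -b • a₁ + a • a₂
  have hD₁ : ∀ v, D₁ v = d • a₁ v - c • a₂ v := fun v => by simp [D₁]
  have hD₂ : ∀ v, D₂ v = -b • a₁ v + a • a₂ v := fun v => by simp [D₂]
  have hDD : ∀ v, D₂ (D₁ v) = D₁ (D₂ v) := by
    intro v; simp [hD₁, hD₂, ka]; module
  have hE₁ : ∀ v, a₁ v = a • D₁ v + c • D₂ v := by
    intro v
    rw [hD₁, hD₂]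
    match_scalars <;> first | ring1 | linear_combination -h1
  have hE₂ : ∀ v, a₂ v = b • D₁ v + d • D₂ v := by
    intro v
    rw [hD₁, hD₂]
    match_scalars <;> first | ring1 | linear_combination -h1
  clear_value D₁ D₂
  have hsq : ∀ v, a₁ (a₁ v) + a₂ (a₂ v) = (a ^ 2 + b ^ 2) • D₁ (D₁ v)
      + (2 * (a * c + b * d)) • D₁ (D₂ v) + (c ^ 2 + d ^ 2) • D₂ (D₂ v) := by
    intro v
    simp only [hE₁, hE₂, map_add, map_smul, hDD]
    module
  obtain ⟨v, hv, h⟩ := exists_eigenvector_of_weyl_relations (a • X + b • Y) (c • X + d • Y) D₁ D₂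
    (by
      intro v
      simp only [hD₁, LinearMap.add_apply, LinearMap.smul_apply, map_add, map_sub, map_smul,
        k11, k12, k21, k22]
      match_scalars <;> first | ring1 | linear_combination h1)
    (by intro v; simp [hD₁, k11, k12, k21, k22]; module)
    (by intro v; simp [hD₂, k11, k12, k21, k22]; module)
    (by
      intro v
      simp only [hD₂, LinearMap.add_apply, LinearMap.smul_apply, map_add, map_smul,
        k11, k12, k21, k22]
      match_scalars <;> first | ring1 | linear_combination h1)
    (by intro v; simp [hXY]; module)
    hDD (a ^ 2 + b ^ 2) (a * c + b * d) (c ^ 2 + d ^ 2) s₁ s₂ hs₁ hs₂ hs hv₀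
    (by simp [hD₁, ha₁, ha₂]) (by simp [hD₂, ha₁, ha₂]) n₁ n₂
  refine ⟨v, hv, ?_⟩
  have h' : ((2 * n₁ + 1) * s₁ + (2 * n₂ + 1) * s₂) • v
      = (2 * n₁ * s₁ + 2 * n₂ * s₂) • v + (s₁ + s₂) • v := by module
  have hXD : ∀ v, q₁₁ • X (a₁ v) + (q₁₂ - β) • Y (a₁ v) + (q₁₂ + β) • X (a₂ v) + q₂₂ • Y (a₂ v)
      = s₁ • (a • X + b • Y) (D₁ v) + s₂ • (c • X + d • Y) (D₂ v) := by
    intro v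
    rw [e11, e12, e21, e22]
    simp only [hD₁, hD₂, LinearMap.add_apply, LinearMap.smul_apply, map_add, map_sub, map_smul]
    module
  rw [hH, h', ← h, hsq, hXD]
  module

theorem hasFDerivAt_ofReal_fst (p : ℝ × ℝ) : HasFDerivAt (fun p : ℝ × ℝ => (p.1 : ℂ))
    (Complex.ofRealCLM ∘L ContinuousLinearMap.fst ℝ ℝ ℝ) p :=
  (Complex.ofRealCLM ∘L ContinuousLinearMap.fst ℝ ℝ ℝ).hasFDerivAt

theorem hasFDerivAt_ofReal_snd (p : ℝ × ℝ) : HasFDerivAt (fun p : ℝ × ℝ => (p.2 : ℂ))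
    (Complex.ofRealCLM ∘L ContinuousLinearMap.snd ℝ ℝ ℝ) p :=
  (Complex.ofRealCLM ∘L ContinuousLinearMap.snd ℝ ℝ ℝ).hasFDerivAt

theorem exists_schwartz_gaussian (q₁₁ q₁₂ q₂₂ : ℂ) {c : ℝ} (hc : 0 < c)
    (hre : ∀ x y : ℝ, c * (x ^ 2 + y ^ 2)
      ≤ q₁₁.re * x ^ 2 + 2 * q₁₂.re * x * y + q₂₂.re * y ^ 2) :
    ∃ u : 𝓢(ℝ × ℝ, ℂ), u ≠ 0 ∧ ∀ p : ℝ × ℝ,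
      fderiv ℝ u p (1, 0) = -(q₁₁ * p.1 + q₁₂ * p.2) * u p ∧
      fderiv ℝ u p (0, 1) = -(q₁₂ * p.1 + q₂₂ * p.2) * u p := by
  let f : ℝ × ℝ → ℂ := fun p =>
    -(1 / 2) * (q₁₁ * (p.1 : ℂ) ^ 2 + 2 * q₁₂ * p.1 * p.2 + q₂₂ * (p.2 : ℂ) ^ 2)
  have h1 : (fun p : ℝ × ℝ => (p.1 : ℂ)).HasTemperateGrowth :=
    (Complex.ofRealCLM ∘L ContinuousLinearMap.fst ℝ ℝ ℝ).hasTemperateGrowth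
  have h2 : (fun p : ℝ × ℝ => (p.2 : ℂ)).HasTemperateGrowth :=
    (Complex.ofRealCLM ∘L ContinuousLinearMap.snd ℝ ℝ ℝ).hasTemperateGrowth
  have hf : f.HasTemperateGrowth := by fun_prop
  have hfre : ∀ p, (f p).re ≤ -(c / 2) * ‖p‖ ^ 2 := by
    rintro ⟨x, y⟩
    have h3 : (f (x, y)).re
        = -(1 / 2) * (q₁₁.re * x ^ 2 + 2 * q₁₂.re * x * y + q₂₂.re * y ^ 2) := by
      simp [f, ← Complex.ofReal_pow]
    have h4 : ‖(x, y)‖ ^ 2 ≤ x ^ 2 + y ^ 2 := by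
      rw [Prod.norm_def]
      rcases max_choice ‖x‖ ‖y‖ with h | h <;> rw [h, Real.norm_eq_abs, sq_abs] <;>
        nlinarith [sq_nonneg x, sq_nonneg y]
    rw [h3]
    nlinarith [hre x y, mul_le_mul_of_nonneg_left h4 hc.le]
  obtain ⟨u, hu⟩ := exists_schwartzMap_cexp hf (half_pos hc) hfre
  refine ⟨u, ?_, fun p => ?_⟩
  · rintro rfl
    exact Complex.exp_ne_zero _ (hu 0).symm
  · have hu' : (u : ℝ × ℝ → ℂ) = fun p => Complex.exp (f p) := funext hu
    have d1 := hasFDerivAt_ofReal_fst p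
    have d2 := hasFDerivAt_ofReal_snd p
    have df := ((((d1.pow 2).const_mul q₁₁).add (((d1.const_mul (2 * q₁₂)).mul d2))).add
      ((d2.pow 2).const_mul q₂₂)).const_mul (-(1 / 2))
    have := df.cexp.fderiv
    rw [hu']
    constructor <;> (refine (congrFun (congrArg DFunLike.coe this) _).trans ?_; simp [f]; ring)

/-- Multiplication of a Schwartz function by the first coordinate. -/
noncomputable def SchwartzMap.mulFst : 𝓢(ℝ × ℝ, ℂ) →ₗ[ℂ] 𝓢(ℝ × ℝ, ℂ) :=
  (smulLeftCLM ℂ (fun p : ℝ × ℝ => (p.1 : ℂ))).toLinearMap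

/-- Multiplication of a Schwartz function by the second coordinate. -/
noncomputable def SchwartzMap.mulSnd : 𝓢(ℝ × ℝ, ℂ) →ₗ[ℂ] 𝓢(ℝ × ℝ, ℂ) :=
  (smulLeftCLM ℂ (fun p : ℝ × ℝ => (p.2 : ℂ))).toLinearMap

/-- The derivative of a Schwartz function in the direction `m`. -/
noncomputable def SchwartzMap.lineDerivLM (m : ℝ × ℝ) : 𝓢(ℝ × ℝ, ℂ) →ₗ[ℂ] 𝓢(ℝ × ℝ, ℂ) :=
  (SchwartzMap.evalCLM ℂ (ℝ × ℝ) ℂ m ∘L fderivCLM ℂ (ℝ × ℝ) ℂ).toLinearMap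

theorem SchwartzMap.mulFst_apply (u : 𝓢(ℝ × ℝ, ℂ)) (p : ℝ × ℝ) : mulFst u p = p.1 * u p :=
  smulLeftCLM_apply_apply
    (Complex.ofRealCLM ∘L ContinuousLinearMap.fst ℝ ℝ ℝ).hasTemperateGrowth u p

theorem SchwartzMap.mulSnd_apply (u : 𝓢(ℝ × ℝ, ℂ)) (p : ℝ × ℝ) : mulSnd u p = p.2 * u p :=
  smulLeftCLM_apply_apply
    (Complex.ofRealCLM ∘L ContinuousLinearMap.snd ℝ ℝ ℝ).hasTemperateGrowth u p

theorem SchwartzMap.lineDerivLM_apply (m : ℝ × ℝ) (u : 𝓢(ℝ × ℝ, ℂ)) (p : ℝ × ℝ) :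
    lineDerivLM m u p = fderiv ℝ u p m := rfl

theorem SchwartzMap.lineDerivLM_mulFst (m : ℝ × ℝ) (u : 𝓢(ℝ × ℝ, ℂ)) :
    lineDerivLM m (mulFst u) = mulFst (lineDerivLM m u) + (m.1 : ℂ) • u := by
  ext p
  have h : (mulFst u : ℝ × ℝ → ℂ) = fun p => (p.1 : ℂ) * u p := funext (mulFst_apply u)
  have := ((hasFDerivAt_ofReal_fst p).mul (u.hasFDerivAt p)).fderiv
  simp only [lineDerivLM_apply, mulFst_apply, add_apply, smul_apply, h]
  refine (congrFun (congrArg DFunLike.coe this) m).trans ?_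
  simp
  ring

theorem SchwartzMap.lineDerivLM_mulSnd (m : ℝ × ℝ) (u : 𝓢(ℝ × ℝ, ℂ)) :
    lineDerivLM m (mulSnd u) = mulSnd (lineDerivLM m u) + (m.2 : ℂ) • u := by
  ext p
  have h : (mulSnd u : ℝ × ℝ → ℂ) = fun p => (p.2 : ℂ) * u p := funext (mulSnd_apply u)
  have := ((hasFDerivAt_ofReal_snd p).mul (u.hasFDerivAt p)).fderiv
  simp only [lineDerivLM_apply, mulSnd_apply, add_apply, smul_apply, h]
  refine (congrFun (congrArg DFunLike.coe this) m).trans ?_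
  simp
  ring

theorem SchwartzMap.mulSnd_mulFst (u : 𝓢(ℝ × ℝ, ℂ)) :
    mulSnd (mulFst u) = mulFst (mulSnd u) := by
  ext p
  simp only [mulFst_apply, mulSnd_apply]
  ring

theorem SchwartzMap.lineDerivLM_comm (m m' : ℝ × ℝ) (u : 𝓢(ℝ × ℝ, ℂ)) :
    lineDerivLM m (lineDerivLM m' u) = lineDerivLM m' (lineDerivLM m u) := by
  ext p
  have hd : DifferentiableAt ℝ (fderiv ℝ u) p :=
    ((u.smooth 2).fderiv_right (m := 1) (by norm_num)).differentiable one_ne_zero p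
  have key : ∀ m₁ m₂ : ℝ × ℝ,
      lineDerivLM m₁ (lineDerivLM m₂ u) p = fderiv ℝ (fderiv ℝ u) p m₁ m₂ := by
    intro m₁ m₂
    have h : (lineDerivLM m₂ u : ℝ × ℝ → ℂ) = fun p => fderiv ℝ u p m₂ := rfl
    rw [lineDerivLM_apply, h, fderiv_clm_apply hd (differentiableAt_const _)]
    simp
  rw [key, key]
  exact (u.smooth 2).contDiffAt.isSymmSndFDerivAt (by simp) m m'

theorem magOp1_schwartzMap (b : ℝ) (u : SchwartzMap (ℝ × ℝ) ℂ) :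
    magOp1 b u = (Complex.I • lineDerivLM (1, 0) u - (b / 2 : ℂ) • mulSnd u :
      SchwartzMap (ℝ × ℝ) ℂ) := by
  ext p
  simp [magOp1, pd1, lineDerivLM_apply, mulSnd_apply]
  ring

theorem magOp2_schwartzMap (b : ℝ) (u : SchwartzMap (ℝ × ℝ) ℂ) :
    magOp2 b u = (Complex.I • lineDerivLM (0, 1) u + (b / 2 : ℂ) • mulFst u :
      SchwartzMap (ℝ × ℝ) ℂ) := by
  ext p
  simp [magOp2, pd2, lineDerivLM_apply, mulFst_apply]
  ring

theorem magnetic_frequencies {b t d s₁ s₂ : ℝ} (hb : 0 < b) (hd : 0 < d) (ht : 0 < t)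
    (htd : 4 * d ≤ t ^ 2)
    (hs₁ : s₁ = (1 / Real.sqrt 2) *
      Real.sqrt (t + b ^ 2 - Real.sqrt ((t + b ^ 2) ^ 2 - 4 * d)))
    (hs₂ : s₂ = (1 / Real.sqrt 2) *
      Real.sqrt (t + b ^ 2 + Real.sqrt ((t + b ^ 2) ^ 2 - 4 * d))) :
    0 < s₁ ∧ s₁ < s₂ ∧ s₁ ^ 2 + s₂ ^ 2 = t + b ^ 2 ∧ (s₁ * s₂) ^ 2 = d := by
  have hb2 : 0 < b ^ 2 := by positivity
  have hD : 0 < (t + b ^ 2) ^ 2 - 4 * d := by nlinarith [mul_pos ht hb2]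
  set R := Real.sqrt ((t + b ^ 2) ^ 2 - 4 * d) with hR
  have hRpos : 0 < R := Real.sqrt_pos.mpr hD
  have hRsq : R ^ 2 = (t + b ^ 2) ^ 2 - 4 * d := Real.sq_sqrt hD.le
  have hRlt : R < t + b ^ 2 := lt_of_pow_lt_pow_left₀ 2 (by positivity) (by linarith)
  have h2 : (1 / Real.sqrt 2) ^ 2 = 1 / 2 := by rw [div_pow, Real.sq_sqrt zero_le_two, one_pow]
  have h1sq : s₁ ^ 2 = (t + b ^ 2 - R) / 2 := by
    rw [hs₁, mul_pow, h2, Real.sq_sqrt (by linarith)]; ring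
  have h2sq : s₂ ^ 2 = (t + b ^ 2 + R) / 2 := by
    rw [hs₂, mul_pow, h2, Real.sq_sqrt (by linarith)]; ring
  refine ⟨?_, ?_, by rw [h1sq, h2sq]; ring, ?_⟩
  · rw [hs₁]
    exact mul_pos (by positivity) (Real.sqrt_pos.mpr (by linarith))
  · rw [hs₁, hs₂]
    exact mul_lt_mul_of_pos_left (Real.sqrt_lt_sqrt (by linarith) (by linarith)) (by positivity)
  · rw [mul_pow, h1sq, h2sq]
    linear_combination (-1 / 4 : ℝ) * hRsq

/-- The eigenvalues of the 2D Schrödinger operator with constant magnetic field `b`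
and positive definite quadratic potential `⟨KX, X⟩` are `(2n₁+1)s₁ + (2n₂+1)s₂`,
each with a nonzero Schwartz eigenfunction. -/
theorem magnetic_oscillator_eigenvalues (b : ℝ) (hb : 0 < b)
    (K : Matrix (Fin 2) (Fin 2) ℝ) (hsymm : K.IsSymm) (hpos : K.PosDef)
    (tK dK s₁ s₂ : ℝ) (htK : tK = K.trace) (hdK : dK = K.det)
    (hs₁ : s₁ = (1 / Real.sqrt 2) *
      Real.sqrt (tK + b ^ 2 - Real.sqrt ((tK + b ^ 2) ^ 2 - 4 * dK)))
    (hs₂ : s₂ = (1 / Real.sqrt 2) *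
      Real.sqrt (tK + b ^ 2 + Real.sqrt ((tK + b ^ 2) ^ 2 - 4 * dK)))
    (n₁ n₂ : ℕ) :
    ∃ u : SchwartzMap (ℝ × ℝ) ℂ, u ≠ 0 ∧ ∀ p : ℝ × ℝ,
      magOp1 b (magOp1 b u) p + magOp2 b (magOp2 b u) p
        + ((K 0 0 * p.1 ^ 2 + 2 * K 0 1 * p.1 * p.2 + K 1 1 * p.2 ^ 2 : ℝ) : ℂ) * u p
      = (((2 * (n₁ : ℝ) + 1) * s₁ + (2 * (n₂ : ℝ) + 1) * s₂ : ℝ) : ℂ) * u p := by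
  have hdpos : 0 < dK := hdK ▸ hpos.det_pos
  have hkpos : 0 < K 0 0 := hpos.diag_pos
  have hlpos : 0 < K 1 1 := hpos.diag_pos
  have hK10 : K 1 0 = K 0 1 := hsymm.apply 0 1
  rw [Matrix.trace_fin_two] at htK
  rw [Matrix.det_fin_two, hK10] at hdK
  generalize K 0 0 = k at *
  generalize K 0 1 = m at *
  generalize K 1 1 = l at *
  have htpos : 0 < tK := by linarith
  obtain ⟨hs₁pos, hs₁₂, hsum, hprod⟩ := magnetic_frequencies hb hdpos htpos
    (by rw [htK, hdK]; nlinarith [sq_nonneg (k - l), sq_nonneg m]) hs₁ hs₂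
  clear hs₁ hs₂
  have hs₂pos : 0 < s₂ := hs₁pos.trans hs₁₂
  obtain ⟨σ, hσ⟩ : ∃ σ, σ = s₁ * s₂ := ⟨_, rfl⟩
  obtain ⟨w, hw⟩ : ∃ w, w = s₁ + s₂ := ⟨_, rfl⟩
  obtain ⟨τ, hτ⟩ : ∃ τ, τ = k + l + 2 * σ := ⟨_, rfl⟩
  have hσpos : 0 < σ := hσ ▸ mul_pos hs₁pos hs₂pos
  have hwpos : 0 < w := hw ▸ add_pos hs₁pos hs₂pos
  have hτpos : 0 < τ := by rw [hτ]; positivity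
  have hσsq : σ ^ 2 = k * l - m ^ 2 := by rw [hσ, hprod, hdK]; ring
  have hwsq : w ^ 2 = τ + b ^ 2 := by
    rw [hw, hτ, hσ]; linear_combination hsum + htK
  have hσsq' : (σ : ℂ) ^ 2 = k * l - m ^ 2 := by exact_mod_cast hσsq
  have hwsq' : (w : ℂ) ^ 2 = τ + b ^ 2 := by exact_mod_cast hwsq
  have hτ' : (τ : ℂ) = k + l + 2 * σ := by exact_mod_cast hτ
  have hσ' : (σ : ℂ) = s₁ * s₂ := by exact_mod_cast hσ
  have hw' : (w : ℂ) = s₁ + s₂ := by exact_mod_cast hw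
  have hτ0 : (τ : ℂ) ≠ 0 := by exact_mod_cast hτpos.ne'
  have hI : Complex.I ^ 2 = -1 := Complex.I_sq
  let q₁₁ : ℂ := (w * (k + σ) - Complex.I * b * m) / τ
  let q₁₂ : ℂ := (w * m + Complex.I * b * (k - l) / 2) / τ
  let q₂₂ : ℂ := (w * (l + σ) + Complex.I * b * m) / τ
  let β : ℂ := Complex.I * b / 2
  have hadd : q₁₂ + β = (w * m + Complex.I * b * (k + σ)) / τ := by
    simp only [q₁₂, β]; field_simp; rw [hτ']; ring
  have hsub : q₁₂ - β = (w * m - Complex.I * b * (l + σ)) / τ := by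
    simp only [q₁₂, β]; field_simp; rw [hτ']; ring
  have hk : (k : ℂ) = q₁₁ ^ 2 + (q₁₂ + β) ^ 2 := by
    rw [hadd]; simp only [q₁₁]; field_simp
    linear_combination (-((k + σ) ^ 2 + m ^ 2) : ℂ) * hwsq' - (b ^ 2 * ((k + σ) ^ 2 + m ^ 2) : ℂ) * hI
      - (τ : ℂ) * hσsq' + (k * τ : ℂ) * hτ'
  have hl : (l : ℂ) = (q₁₂ - β) ^ 2 + q₂₂ ^ 2 := by
    rw [hsub]; simp only [q₂₂]; field_simp
    linear_combination (-((l + σ) ^ 2 + m ^ 2) : ℂ) * hwsq' - (b ^ 2 * ((l + σ) ^ 2 + m ^ 2) : ℂ) * hI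
      - (τ : ℂ) * hσsq' + (l * τ : ℂ) * hτ'
  have hm : (m : ℂ) = q₁₁ * (q₁₂ - β) + (q₁₂ + β) * q₂₂ := by
    rw [hadd, hsub]; simp only [q₁₁, q₂₂]; field_simp
    linear_combination (-(m * (k + l + 2 * σ)) : ℂ) * hwsq'
      - (b ^ 2 * (m * (k + l + 2 * σ)) : ℂ) * hI + (m * τ : ℂ) * hτ'
  have htr : q₁₁ + q₂₂ = s₁ + s₂ := by
    simp only [q₁₁, q₂₂]; field_simp
    linear_combination (-w : ℂ) * hτ' + (τ : ℂ) * hw'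
  have hdet : q₁₁ * q₂₂ - (q₁₂ - β) * (q₁₂ + β) = s₁ * s₂ := by
    rw [hadd, hsub]; simp only [q₁₁, q₂₂]; field_simp
    linear_combination ((k + σ) * (l + σ) - m ^ 2 : ℂ) * hwsq'
      + (b ^ 2 * ((k + σ) * (l + σ) - m ^ 2) : ℂ) * hI - (τ : ℂ) * hσsq' - (σ * τ : ℂ) * hτ'
      + (τ ^ 2 : ℂ) * hσ'
  obtain ⟨v₀, hv₀, hv⟩ := exists_schwartz_gaussian q₁₁ q₁₂ q₂₂ (c := w * σ / τ) (by positivity) (by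
    intro x y
    have e1 : q₁₁.re = w * (k + σ) / τ := by simp [q₁₁]
    have e2 : q₁₂.re = w * m / τ := by simp [q₁₂]
    have e3 : q₂₂.re = w * (l + σ) / τ := by simp [q₂₂]
    have e4 : 0 ≤ k * x ^ 2 + 2 * m * x * y + l * y ^ 2 := by
      have : k * (k * x ^ 2 + 2 * m * x * y + l * y ^ 2) = (k * x + m * y) ^ 2 + (σ * y) ^ 2 := by
        linear_combination (-y ^ 2) * hσsq
      exact nonneg_of_mul_nonneg_right (this ▸ by positivity) hkpos
    rw [e1, e2, e3, ← sub_nonneg]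
    have e5 : 0 ≤ w / τ * (k * x ^ 2 + 2 * m * x * y + l * y ^ 2) := by positivity
    refine e5.trans_eq ?_
    ring)
  obtain ⟨u, hu, h⟩ := exists_eigenvector_of_magnetic_oscillator mulFst mulSnd
    (lineDerivLM (1, 0)) (lineDerivLM (0, 1))
    (fun v => by simp [lineDerivLM_mulFst]) (fun v => by simp [lineDerivLM_mulSnd])
    (fun v => by simp [lineDerivLM_mulFst]) (fun v => by simp [lineDerivLM_mulSnd])
    mulSnd_mulFst (lineDerivLM_comm _ _) β q₁₁ q₁₂ q₂₂ k m l s₁ s₂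
    (by simp [β, hb.ne']) hk hl hm htr hdet (by exact_mod_cast hs₁pos.ne')
    (by exact_mod_cast hs₂pos.ne') (by exact_mod_cast (add_pos hs₁pos hs₂pos).ne')
    (by exact_mod_cast hs₁₂.ne) hv₀
    (by
      ext p
      simp only [lineDerivLM_apply, (hv p).1, neg_apply, add_apply, smul_apply, mulFst_apply,
        mulSnd_apply, smul_eq_mul]
      ring)
    (by
      ext p
      simp only [lineDerivLM_apply, (hv p).2, neg_apply, add_apply, smul_apply, mulFst_apply,
        mulSnd_apply, smul_eq_mul]
      ring) n₁ n₂
  refine ⟨u, hu, fun p => ?_⟩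
  have hp := congrArg (fun f : SchwartzMap (ℝ × ℝ) ℂ => f p) h
  rw [magOp1_schwartzMap, magOp1_schwartzMap, magOp2_schwartzMap, magOp2_schwartzMap]
  simp only [map_add, map_sub, map_smul, lineDerivLM_mulFst, lineDerivLM_mulSnd, neg_apply,
    add_apply, sub_apply, smul_apply, mulFst_apply, mulSnd_apply, smul_eq_mul, β] at hp ⊢
  push_cast at hp ⊢
  linear_combination hp + (lineDerivLM (1, 0) (lineDerivLM (1, 0) u) p
    + lineDerivLM (0, 1) (lineDerivLM (0, 1) u) p
    + (b : ℂ) ^ 2 * (p.1 ^ 2 + p.2 ^ 2) * u p / 4) * hI
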